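/- arXiv:1612.04133 — 11 statements merged into one kernel-verified Lean document; each statement's English description precedes it below -/
import Mathlib

section
/- With the notation of the bicoloured block decomposition, the matrix c = c_b·c_w is invertible with inverse c_w·c_b, and one has the identity (2·1_r − A)^2 = c_b·c_w + c_w·c_b + 2·1_r, i.e. (2I − A)^2 = c + c^{−1} + 2. (Identity (3.3.1).) -/
/-- **Identity (3.3.1).** With the bicoloured block decomposition of the Cartan matrix
`A = [[2·1_p, X],[Y, 2·1_q]]` and `c_b = [[-1, -X],[0, 1]]`, `c_w = [[1, 0],[-Y, -1]]`,
`c = c_b·c_w`, the matrix `c` is invertible with inverse `c_w·c_b`, and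
`(2·1 - A)² = c + c⁻¹ + 2·1`. -/
theorem stmt1 (p q : ℕ) (X : Matrix (Fin p) (Fin q) ℝ) (Y : Matrix (Fin q) (Fin p) ℝ)
    (A cb cw c : Matrix (Fin p ⊕ Fin q) (Fin p ⊕ Fin q) ℝ)
    (hA : A = Matrix.fromBlocks ((2 : ℝ) • 1) X Y ((2 : ℝ) • 1))
    (hcb : cb = Matrix.fromBlocks (-1) (-X) 0 1)
    (hcw : cw = Matrix.fromBlocks 1 0 (-Y) (-1))
    (hc : c = cb * cw) :
    c * (cw * cb) = 1 ∧ (cw * cb) * c = 1 ∧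
      ((2 : ℝ) • 1 - A) ^ 2 = c + cw * cb + (2 : ℝ) • 1 := by
  have hb : cb * cb = 1 := by
    simp [hcb, Matrix.fromBlocks_multiply, ← Matrix.fromBlocks_one]
  have hw : cw * cw = 1 := by
    simp [hcw, Matrix.fromBlocks_multiply, ← Matrix.fromBlocks_one]
  have hsum : (2 : ℝ) • 1 - A = cb + cw := by
    rw [hA, hcb, hcw, ← Matrix.fromBlocks_one, Matrix.fromBlocks_smul, sub_eq_add_neg,
      Matrix.fromBlocks_neg, Matrix.fromBlocks_add, Matrix.fromBlocks_add]
    simp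
  subst hc
  refine ⟨?_, ?_, ?_⟩
  · rw [mul_assoc, ← mul_assoc cw, hw, one_mul, hb]
  · rw [mul_assoc, ← mul_assoc cb, hb, one_mul, hw]
  · rw [hsum, sq, add_mul, mul_add, mul_add, hb, hw, two_smul]
    abel
end

section
/- Regard A and c = c_b·c_w as complex matrices. If θ is a real number such that e^{2iθ} is an eigenvalue of c, then at least one of the two numbers 2(1 − cos θ) and 2(1 + cos θ) is an eigenvalue of A. (Lemma 3.3, eigenvalue step.) -/
/-- **Lemma 3.3 (eigenvalue step).** Regard `A` and `c = c_b·c_w` as complex matrices.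
If `θ ∈ ℝ` is such that `e^{2iθ}` is an eigenvalue of `c`, then `2(1 - cos θ)` or
`2(1 + cos θ)` is an eigenvalue of `A`. -/
theorem stmt2 (p q : ℕ) (X : Matrix (Fin p) (Fin q) ℝ) (Y : Matrix (Fin q) (Fin p) ℝ)
    (A cb cw c : Matrix (Fin p ⊕ Fin q) (Fin p ⊕ Fin q) ℂ)
    (hA : A = Matrix.fromBlocks ((2 : ℂ) • 1) (X.map Complex.ofReal) (Y.map Complex.ofReal)
      ((2 : ℂ) • 1))
    (hcb : cb = Matrix.fromBlocks (-1) (-(X.map Complex.ofReal)) 0 1)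
    (hcw : cw = Matrix.fromBlocks 1 0 (-(Y.map Complex.ofReal)) (-1))
    (hc : c = cb * cw)
    (θ : ℝ)
    (hθ : ∃ v : Fin p ⊕ Fin q → ℂ, v ≠ 0 ∧
      c.mulVec v = Complex.exp (2 * θ * Complex.I) • v) :
    (∃ v : Fin p ⊕ Fin q → ℂ, v ≠ 0 ∧
      A.mulVec v = ((2 * (1 - Real.cos θ) : ℝ) : ℂ) • v) ∨
    (∃ v : Fin p ⊕ Fin q → ℂ, v ≠ 0 ∧
      A.mulVec v = ((2 * (1 + Real.cos θ) : ℝ) : ℂ) • v) := by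
  obtain ⟨v, hv, hcv⟩ := hθ
  obtain ⟨x, y, rfl⟩ : ∃ x y, v = Sum.elim x y :=
    ⟨v ∘ Sum.inl, v ∘ Sum.inr, (Sum.elim_comp_inl_inr v).symm⟩
  set X' : Matrix (Fin p) (Fin q) ℂ := X.map Complex.ofReal
  set Y' : Matrix (Fin q) (Fin p) ℂ := Y.map Complex.ofReal
  set t : ℂ := Complex.exp (θ * Complex.I) with ht
  have ht0 : t ≠ 0 := Complex.exp_ne_zero _
  have hsq : Complex.exp (2 * θ * Complex.I) = t ^ 2 := by
    rw [ht, ← Complex.exp_nat_mul]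
    congr 1
    push_cast
    ring
  have hcos : 2 * Complex.cos θ * t = 1 + t ^ 2 := by
    have hinv : Complex.exp (-θ * Complex.I) * t = 1 := by
      rw [ht, ← Complex.exp_add, neg_mul, neg_add_cancel, Complex.exp_zero]
    rw [Complex.two_cos, ← ht, add_mul, hinv]
    ring
  rw [hsq, hc, ← Matrix.mulVec_mulVec, hcw, hcb, Matrix.fromBlocks_mulVec,
    Matrix.fromBlocks_mulVec] at hcv
  have hy : Y'.mulVec x = -(1 + t ^ 2) • y := by
    ext j
    have h := congrFun hcv (Sum.inr j)
    simp [Matrix.neg_mulVec] at h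
    simp only [Pi.smul_apply, smul_eq_mul]
    linear_combination -h
  have hx : t • X'.mulVec y = -(2 * Complex.cos θ) • x := by
    ext i
    have h := congrFun hcv (Sum.inl i)
    have hvec : -Y'.mulVec x + -y = t ^ 2 • y := by
      rw [hy]
      module
    simp [Matrix.neg_mulVec] at h
    simp only [hvec, Matrix.mulVec_smul, Pi.smul_apply, smul_eq_mul] at h
    apply mul_left_cancel₀ ht0
    simp only [Pi.smul_apply, smul_eq_mul]
    linear_combination -h + x i * hcos
  refine Or.inl ⟨Sum.elim x (t • y), fun h0 => hv ?_, ?_⟩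
  · have h1 : x = 0 := funext fun i => congrFun h0 (Sum.inl i)
    have h2 : t • y = 0 := funext fun j => congrFun h0 (Sum.inr j)
    rw [h1, (smul_eq_zero.mp h2).resolve_left ht0]
    exact Sum.elim_zero_zero
  · rw [hA, Matrix.fromBlocks_mulVec]
    ext (i | j)
    · simp [Matrix.smul_mulVec, Matrix.mulVec_smul]
      have h := congrFun hx i
      simp only [Pi.smul_apply, smul_eq_mul] at h
      linear_combination h
    · simp [Matrix.smul_mulVec]
      have h := congrFun hy j
      simp only [Pi.smul_apply, smul_eq_mul] at h
      linear_combination h + y j * hcos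
end

section
/- Duality Lemma: let θ ∈ ℝ and let x ∈ ℝ^r satisfy ∑_{i=1}^r x_i A_{ij} = 2(1 − cos θ)·x_j for every j = 1,…,r. Then ∑_{i=1}^r ε(i)·x_i·A_{ij} = 2(1 + cos θ)·ε(j)·x_j for every j = 1,…,r; that is, the sign-twisted vector (ε(1)x_1,…,ε(r)x_r) is a row eigenvector of A with eigenvalue 2(1 + cos θ). (Lemma 3.5.) -/
/-- **Duality Lemma (Lemma 3.5).** If a row vector `x` satisfies
`∑_i x_i A_{ij} = 2(1 - cos θ)·x_j` for all `j`, then the sign-twisted vector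
`(ε(1)x_1, …, ε(r)x_r)` (with `ε = +1` on black indices, `-1` on white indices)
is a row eigenvector of `A` with eigenvalue `2(1 + cos θ)`. -/
theorem stmt3 (p q : ℕ) (X : Matrix (Fin p) (Fin q) ℝ) (Y : Matrix (Fin q) (Fin p) ℝ)
    (A : Matrix (Fin p ⊕ Fin q) (Fin p ⊕ Fin q) ℝ)
    (hA : A = Matrix.fromBlocks ((2 : ℝ) • 1) X Y ((2 : ℝ) • 1))
    (ε : Fin p ⊕ Fin q → ℝ)
    (hε : ε = Sum.elim (fun _ => (1 : ℝ)) (fun _ => (-1 : ℝ)))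
    (θ : ℝ) (x : Fin p ⊕ Fin q → ℝ)
    (hx : ∀ j, ∑ i, x i * A i j = 2 * (1 - Real.cos θ) * x j) :
    ∀ j, ∑ i, ε i * x i * A i j = 2 * (1 + Real.cos θ) * (ε j * x j) := by
  subst hA hε
  rintro (j | j)
  · have h := hx (Sum.inl j)
    simp [Fintype.sum_sum_type, Matrix.one_apply] at h ⊢
    linarith
  · have h := hx (Sum.inr j)
    simp [Fintype.sum_sum_type, Matrix.one_apply] at h ⊢
    linarith
end

section
/- Let θ ∈ ℝ and let v ∈ ℝ^r be a column vector with A v = 2(1 − cos θ)·v. Write v = v_b + v_w where (v_b)_i = v_i for i ≤ p and (v_b)_i = 0 for i > p, and v_w = v − v_b. Then: (a) c_b·v_b = −v_b and c_w·v_w = −v_w; (b) c_w·v_b = v_b + 2cos θ·v_w and c_b·v_w = v_w + 2cos θ·v_b. (Lemma 3.6.) -/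
/-- **Lemma 3.6.** Let `A v = 2(1 - cos θ)·v` and write `v = v_b + v_w` (black and white
components). Then (a) `c_b·v_b = -v_b`, `c_w·v_w = -v_w`;
(b) `c_w·v_b = v_b + 2cos θ·v_w`, `c_b·v_w = v_w + 2cos θ·v_b`. -/
theorem stmt4 (p q : ℕ) (X : Matrix (Fin p) (Fin q) ℝ) (Y : Matrix (Fin q) (Fin p) ℝ)
    (A cb cw : Matrix (Fin p ⊕ Fin q) (Fin p ⊕ Fin q) ℝ)
    (hA : A = Matrix.fromBlocks ((2 : ℝ) • 1) X Y ((2 : ℝ) • 1))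
    (hcb : cb = Matrix.fromBlocks (-1) (-X) 0 1)
    (hcw : cw = Matrix.fromBlocks 1 0 (-Y) (-1))
    (θ : ℝ) (v vb vw : Fin p ⊕ Fin q → ℝ)
    (hv : A.mulVec v = (2 * (1 - Real.cos θ)) • v)
    (hvb₁ : ∀ a : Fin p, vb (Sum.inl a) = v (Sum.inl a))
    (hvb₂ : ∀ b : Fin q, vb (Sum.inr b) = 0)
    (hvw : vw = v - vb) :
    cb.mulVec vb = -vb ∧ cw.mulVec vw = -vw ∧
      cw.mulVec vb = vb + (2 * Real.cos θ) • vw ∧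
      cb.mulVec vw = vw + (2 * Real.cos θ) • vb := by
  obtain ⟨x, y, rfl⟩ : ∃ x y, v = Sum.elim x y := ⟨_, _, (Sum.elim_comp_inl_inr v).symm⟩
  obtain rfl : vb = Sum.elim x (0 : Fin q → ℝ) := by
    ext (a | b)
    · exact hvb₁ a
    · exact hvb₂ b
  obtain rfl : vw = Sum.elim (0 : Fin p → ℝ) y := by
    rw [hvw]
    ext (a | b) <;> simp
  subst hA hcb hcw
  have hX (a : Fin p) : X.mulVec y a = -(2 * Real.cos θ * x a) := by
    have h := congrFun hv (Sum.inl a)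
    simp [Matrix.fromBlocks_mulVec, Matrix.smul_mulVec] at h
    linarith
  have hY (b : Fin q) : Y.mulVec x b = -(2 * Real.cos θ * y b) := by
    have h := congrFun hv (Sum.inr b)
    simp [Matrix.fromBlocks_mulVec, Matrix.smul_mulVec] at h
    linarith
  refine ⟨?_, ?_, ?_, ?_⟩ <;> ext (a | b) <;>
    simp [Matrix.fromBlocks_mulVec, Matrix.neg_mulVec, hX, hY]
end

section
/- Let θ ∈ ℝ and let v ∈ ℝ^r be a column vector with A v = 2(1 − cos θ)·v; write v = v_b + v_w where (v_b)_i = v_i for i ≤ p and 0 for i > p, and v_w = v − v_b. Then the complex vector y = e^{iθ/2}·v_b + e^{−iθ/2}·v_w satisfies c·y = e^{2iθ}·y, i.e. y is an eigenvector of the Coxeter-type matrix c = c_b·c_w with eigenvalue e^{2iθ} (provided y ≠ 0). (Corollary 3.7.) -/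
open Matrix in
/-- If `X w = -(z² + z⁻²) b` and `Y b = -(z² + z⁻²) w`, then `(z b, z⁻¹ w)` is an eigenvector of the
product of the two bipartite reflections with eigenvalue `z⁴`. -/
theorem coxeter_mulVec_sumElim {R m n : Type*} [CommRing R] [Fintype m] [Fintype n]
    [DecidableEq m] [DecidableEq n] (X : Matrix m n R) (Y : Matrix n m R) (b : m → R) (w : n → R)
    {z z' : R} (hz : z * z' = 1) (hX : X *ᵥ w = (-(z ^ 2 + z' ^ 2)) • b)
    (hY : Y *ᵥ b = (-(z ^ 2 + z' ^ 2)) • w) :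
    (fromBlocks (-1) (-X) 0 1 * fromBlocks 1 0 (-Y) (-1)) *ᵥ Sum.elim (z • b) (z' • w) =
      z ^ 4 • Sum.elim (z • b) (z' • w) := by
  have hw : fromBlocks 1 0 (-Y) (-1) *ᵥ Sum.elim (z • b) (z' • w) =
      Sum.elim (z • b) (z ^ 3 • w) := by
    rw [fromBlocks_mulVec]
    ext (i | i)
    · simp
    · simp [neg_mulVec, mulVec_smul, hY]
      linear_combination (z' * w i) * hz
  rw [← mulVec_mulVec, hw, fromBlocks_mulVec]
  ext (i | i)
  · simp [neg_mulVec, mulVec_smul, hX]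
    linear_combination (z * b i) * (z * z' + 1) * hz
  · simp
    linear_combination (-z ^ 3 * w i) * hz

/-- **Corollary 3.7.** Let `A v = 2(1 - cos θ)·v`, `v = v_b + v_w` (black/white components).
Then the complex vector `y = e^{iθ/2}·v_b + e^{-iθ/2}·v_w` satisfies `c·y = e^{2iθ}·y`,
where `c = c_b·c_w`. -/
theorem stmt5 (p q : ℕ) (X : Matrix (Fin p) (Fin q) ℝ) (Y : Matrix (Fin q) (Fin p) ℝ)
    (A : Matrix (Fin p ⊕ Fin q) (Fin p ⊕ Fin q) ℝ)
    (cb cw c : Matrix (Fin p ⊕ Fin q) (Fin p ⊕ Fin q) ℂ)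
    (hA : A = Matrix.fromBlocks ((2 : ℝ) • 1) X Y ((2 : ℝ) • 1))
    (hcb : cb = Matrix.fromBlocks (-1) (-(X.map Complex.ofReal)) 0 1)
    (hcw : cw = Matrix.fromBlocks 1 0 (-(Y.map Complex.ofReal)) (-1))
    (hc : c = cb * cw)
    (θ : ℝ) (v vb vw : Fin p ⊕ Fin q → ℝ)
    (hv : A.mulVec v = (2 * (1 - Real.cos θ)) • v)
    (hvb₁ : ∀ a : Fin p, vb (Sum.inl a) = v (Sum.inl a))
    (hvb₂ : ∀ b : Fin q, vb (Sum.inr b) = 0)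
    (hvw : vw = v - vb)
    (y : Fin p ⊕ Fin q → ℂ)
    (hy : y = fun i => Complex.exp (θ / 2 * Complex.I) * (vb i : ℂ) +
      Complex.exp (-(θ / 2) * Complex.I) * (vw i : ℂ)) :
    c.mulVec y = Complex.exp (2 * θ * Complex.I) • y := by
  have hz : Complex.exp (θ / 2 * Complex.I) * Complex.exp (-(θ / 2) * Complex.I) = 1 := by
    rw [← Complex.exp_add]
    simp
  have hcos : Complex.exp (θ / 2 * Complex.I) ^ 2 + Complex.exp (-(θ / 2) * Complex.I) ^ 2 =
      2 * Complex.cos θ := by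
    rw [Complex.two_cos, ← Complex.exp_nat_mul, ← Complex.exp_nat_mul]
    congr 2 <;> push_cast <;> ring
  have hpow : Complex.exp (2 * θ * Complex.I) = Complex.exp (θ / 2 * Complex.I) ^ 4 := by
    rw [← Complex.exp_nat_mul]
    congr 1
    push_cast
    ring
  have hyv : y = Sum.elim (Complex.exp (θ / 2 * Complex.I) • fun a => (v (Sum.inl a) : ℂ))
      (Complex.exp (-(θ / 2) * Complex.I) • fun a => (v (Sum.inr a) : ℂ)) := by
    subst hy hvw
    ext (i | i) <;> simp [hvb₁, hvb₂]
  rw [hA, Matrix.fromBlocks_mulVec] at hv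
  rw [hc, hcb, hcw, hyv, hpow]
  apply coxeter_mulVec_sumElim _ _ _ _ hz
  · ext i
    have h := congrArg Complex.ofReal (congrFun hv (Sum.inl i))
    simp [Matrix.smul_mulVec, Matrix.mulVec, dotProduct] at h
    simp only [Matrix.mulVec, dotProduct, Matrix.map_apply, Pi.smul_apply, smul_eq_mul, hcos]
    linear_combination h
  · ext i
    have h := congrArg Complex.ofReal (congrFun hv (Sum.inr i))
    simp [Matrix.smul_mulVec, Matrix.mulVec, dotProduct] at h
    simp only [Matrix.mulVec, dotProduct, Matrix.map_apply, Pi.smul_apply, smul_eq_mul, hcos]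
    linear_combination h
end

section
/- Let θ ∈ ℝ and let x ∈ ℝ^r satisfy ∑_{i=1}^r x_i A_{ij} = 2(1 − cos θ)·x_j for every j = 1,…,r. Then for every j = 1,…,r one has the complex identity e^{iθ/2}·(∑_{i=1}^p x_i A_{ij}) + e^{−iθ/2}·(∑_{i=p+1}^r x_i A_{ij}) = 2·i·ε(j)·e^{−i·ε(j)·θ/2}·sin θ·x_j. (This is Lemma 3.8: it computes the pairing (y, α_j) of the Coxeter eigenvector y = e^{iθ/2}x_b + e^{−iθ/2}x_w with each simple root, after dividing by (α_j,α_j)/2.) -/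
theorem Complex.exp_half_mul_I (z : ℂ) :
    Complex.exp (z / 2 * Complex.I) =
      (Complex.cos z + Complex.sin z * Complex.I) * Complex.exp (-(z / 2) * Complex.I) := by
  rw [← Complex.exp_mul_I, ← Complex.exp_add]
  ring_nf


/-- **Lemma 3.8.** If the row vector `x` satisfies `∑_i x_i A_{ij} = 2(1 - cos θ)·x_j`
for all `j`, then for every `j`:
`e^{iθ/2}·(∑_{i black} x_i A_{ij}) + e^{-iθ/2}·(∑_{i white} x_i A_{ij})
  = 2·i·ε(j)·e^{-i·ε(j)·θ/2}·sin θ·x_j`. -/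
theorem stmt6 (p q : ℕ) (X : Matrix (Fin p) (Fin q) ℝ) (Y : Matrix (Fin q) (Fin p) ℝ)
    (A : Matrix (Fin p ⊕ Fin q) (Fin p ⊕ Fin q) ℝ)
    (hA : A = Matrix.fromBlocks ((2 : ℝ) • 1) X Y ((2 : ℝ) • 1))
    (ε : Fin p ⊕ Fin q → ℝ)
    (hε : ε = Sum.elim (fun _ => (1 : ℝ)) (fun _ => (-1 : ℝ)))
    (θ : ℝ) (x : Fin p ⊕ Fin q → ℝ)
    (hx : ∀ j, ∑ i, x i * A i j = 2 * (1 - Real.cos θ) * x j) :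
    ∀ j, Complex.exp ((θ : ℂ) / 2 * Complex.I) *
        (↑(∑ a : Fin p, x (Sum.inl a) * A (Sum.inl a) j) : ℂ) +
      Complex.exp (-((θ : ℂ) / 2) * Complex.I) *
        (↑(∑ b : Fin q, x (Sum.inr b) * A (Sum.inr b) j) : ℂ) =
      2 * Complex.I * (ε j : ℂ) * Complex.exp (-((ε j : ℂ) * θ / 2) * Complex.I) *
        (Real.sin θ : ℂ) * (x j : ℂ) := by
  subst hA hε
  have hpos := Complex.exp_half_mul_I θ
  have hneg := Complex.exp_half_mul_I (-θ)
  rw [Complex.cos_neg, Complex.sin_neg, neg_div, neg_neg] at hneg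
  rintro (j | j)
  · have hj := hx (Sum.inl j)
    have hblack : ∑ a : Fin p, x (Sum.inl a) *
        Matrix.fromBlocks ((2 : ℝ) • 1) X Y ((2 : ℝ) • 1) (Sum.inl a) (Sum.inl j) =
          2 * x (Sum.inl j) := by
      simp [Matrix.one_apply, mul_comm]
    rw [Fintype.sum_sum_type, hblack] at hj
    rw [hblack, eq_sub_of_add_eq' hj]
    simp only [Sum.elim_inl]
    push_cast
    rw [one_mul]
    linear_combination 2 * (x (Sum.inl j) : ℂ) * hpos
  · have hj := hx (Sum.inr j)
    have hwhite : ∑ b : Fin q, x (Sum.inr b) *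
        Matrix.fromBlocks ((2 : ℝ) • 1) X Y ((2 : ℝ) • 1) (Sum.inr b) (Sum.inr j) =
          2 * x (Sum.inr j) := by
      simp [Matrix.one_apply, mul_comm]
    rw [Fintype.sum_sum_type, hwhite] at hj
    rw [hwhite, eq_sub_of_add_eq hj]
    simp only [Sum.elim_inr]
    push_cast
    rw [neg_one_mul, neg_div, neg_neg]
    linear_combination 2 * (x (Sum.inr j) : ℂ) * hneg
end

section
/- Let L be a Lie algebra over ℂ, σ : L ≃ L a Lie algebra automorphism, ζ a nonzero complex number, m an integer, and h a natural number. Suppose x, y ∈ L satisfy σ(x) = ζ^m·x and σ(y) = ζ^{−m}·y, and e ∈ L, a, b ∈ ℂ satisfy ⁅x, e⁆ = a·e and ⁅y, e⁆ = b·e. Set A = ∑_{k=0}^{h−1} σ^k(e). Then ⁅y, ⁅x, A⁆⁆ = a·b·A; in particular A is an eigenvector of the operator ad_y ∘ ad_x with eigenvalue a·b. (Theorem 2.4.) -/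
/-- If `z` is an eigenvector of a Lie algebra automorphism `σ` with eigenvalue `c`, and `e` is an
eigenvector of `ad_z` with eigenvalue `a`, then `σ^k e` is an eigenvector of `c ^ k • ad_z` with
eigenvalue `a`. -/
theorem LieEquiv.pow_smul_lie_iterate {R L : Type*} [CommRing R] [LieRing L] [LieAlgebra R L]
    (σ : L ≃ₗ⁅R⁆ L) {c a : R} {z e : L} (hz : σ z = c • z) (hze : ⁅z, e⁆ = a • e) (k : ℕ) :
    c ^ k • ⁅z, (⇑σ)^[k] e⁆ = a • (⇑σ)^[k] e := by
  induction k with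
  | zero => simpa using hze
  | succ k ih =>
    have key := congrArg σ ih
    rw [map_smul, map_smul, LieEquiv.map_lie, hz, smul_lie, smul_smul, ← pow_succ] at key
    rwa [Function.iterate_succ_apply']

/-- **Theorem 2.4.** Let `L` be a complex Lie algebra, `σ` a Lie algebra automorphism,
`ζ ≠ 0`, `m ∈ ℤ`, `h ∈ ℕ`. Suppose `σ(x) = ζ^m·x`, `σ(y) = ζ^{-m}·y`, `⁅x, e⁆ = a·e`,
`⁅y, e⁆ = b·e`. Set `A = ∑_{k=0}^{h-1} σ^k(e)`. Then `⁅y, ⁅x, A⁆⁆ = a·b·A`, i.e. `A`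
is an eigenvector of `ad_y ∘ ad_x` with eigenvalue `a·b`. -/
theorem stmt8 {L : Type*} [LieRing L] [LieAlgebra ℂ L]
    (σ : L ≃ₗ⁅ℂ⁆ L) (ζ : ℂ) (hζ : ζ ≠ 0) (m : ℤ) (h : ℕ)
    (x y e : L) (a b : ℂ)
    (hx : σ x = ζ ^ m • x)
    (hy : σ y = ζ ^ (-m) • y)
    (hex : ⁅x, e⁆ = a • e)
    (hey : ⁅y, e⁆ = b • e)
    (A : L) (hA : A = ∑ k ∈ Finset.range h, (⇑σ)^[k] e) :
    ⁅y, ⁅x, A⁆⁆ = (a * b) • A := by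
  have hc : ζ ^ m ≠ 0 := zpow_ne_zero m hζ
  rw [hA, lie_sum, lie_sum, Finset.smul_sum]
  refine Finset.sum_congr rfl fun k _ => ?_
  have h₁ := σ.pow_smul_lie_iterate hx hex k
  have h₂ := σ.pow_smul_lie_iterate hy hey k
  have hone : (ζ ^ (-m)) ^ k * (ζ ^ m) ^ k = 1 := by
    rw [← mul_pow, zpow_neg, inv_mul_cancel₀ hc, one_pow]
  calc ⁅y, ⁅x, (⇑σ)^[k] e⁆⁆
      = (ζ ^ (-m)) ^ k • ⁅y, (ζ ^ m) ^ k • ⁅x, (⇑σ)^[k] e⁆⁆ := by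
        rw [lie_smul, smul_smul, hone, one_smul]
    _ = (a * b) • (⇑σ)^[k] e := by
        rw [h₁, lie_smul, smul_comm, h₂, smul_smul]
end

section
/- Let g be a finite-dimensional complex semisimple Lie algebra (Killing form κ nondegenerate) with splitting Cartan subalgebra H, and for a linear functional β on H let g_β denote the corresponding weight (root) space; β is a root if β ≠ 0 and g_β ≠ 0. Let α_0, α_1, …, α_r be roots and n_0, …, n_r complex numbers with ∑_{i=0}^r n_i·α_i = 0, and suppose that for all i ≠ j the functional α_i − α_j is neither zero nor a root. Let x_i ∈ g_{α_i} and y_i ∈ g_{−α_i} satisfy κ(x_i, y_i) = n_i for each i. Then ⁅∑_{i=0}^r x_i, ∑_{i=0}^r y_i⁆ = 0. (Lemma 1.3.1: the commuting of the cyclic elements E and Ẽ.) -/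
open LieAlgebra LieAlgebra.IsKilling LieModule in
/-- For a linear functional `β` on `H`, the bracket of a `β`-eigenvector with a `-β`-eigenvector
is their Killing pairing times the element of `H` dual to `β`. -/
theorem lie_eq_killingForm_smul_cartanEquivDual_symm {K L : Type*} [Field K] [CharZero K]
    [LieRing L] [LieAlgebra K L] [FiniteDimensional K L] [IsKilling K L]
    (H : LieSubalgebra K L) [H.IsCartanSubalgebra] [IsTriangularizable K H L]
    {β : Module.Dual K H} {e f : L} (he : ∀ h : H, ⁅(h : L), e⁆ = β h • e)
    (hf : ∀ h : H, ⁅(h : L), f⁆ = -(β h) • f) :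
    ⁅e, f⁆ = killingForm K L e f • ((cartanEquivDual H).symm β : L) := by
  rcases eq_or_ne e 0 with rfl | he₀
  · simp
  have heβ : e ∈ rootSpace H β := (mem_genWeightSpace L (β : H → K) e).mpr fun h ↦
    ⟨1, by simp [← he h]⟩
  have hfβ : f ∈ rootSpace H (-β : H → K) := (mem_genWeightSpace L (-β : H → K) f).mpr fun h ↦
    ⟨1, by simp [hf h]⟩
  let w : Weight K H L :=
    ⟨β, fun hbot ↦ he₀ <| (LieSubmodule.mem_bot e).mp (hbot.le heβ)⟩
  have hw : Weight.toLinear K H L w = β := by ext h; rfl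
  rw [← hw]
  exact lie_eq_killingForm_smul_of_mem_rootSpace_of_mem_rootSpace_neg (α := w) heβ hfβ

/-- The bracket of a `β`-eigenvector with a `γ`-eigenvector is a `(β + γ)`-eigenvector. -/
theorem lie_lie_eq_add_smul {K L : Type*} [CommRing K] [LieRing L] [LieAlgebra K L]
    {h e f : L} {b c : K} (he : ⁅h, e⁆ = b • e) (hf : ⁅h, f⁆ = c • f) :
    ⁅h, ⁅e, f⁆⁆ = (b + c) • ⁅e, f⁆ := by
  rw [leibniz_lie, he, hf, smul_lie, lie_smul, add_smul]

/-- **Lemma 1.3.1.** Let `g` be a finite-dimensional complex semisimple Lie algebra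
(nondegenerate Killing form) with a splitting Cartan subalgebra `H`. For a linear
functional `β` on `H`, the root space `g_β` is the simultaneous eigenspace
`{z | ⁅h, z⁆ = β(h)·z for all h ∈ H}`; `β` is a root if `β ≠ 0` and `g_β ≠ 0`.
Let `α_0, …, α_r` be roots and `n_0, …, n_r ∈ ℂ` with `∑ n_i·α_i = 0`, such that
for `i ≠ j` the functional `α_i - α_j` is neither zero nor a root. If `x_i ∈ g_{α_i}`,
`y_i ∈ g_{-α_i}` and `κ(x_i, y_i) = n_i`, then `⁅∑ x_i, ∑ y_i⁆ = 0`. -/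
theorem stmt11 {g : Type*} [LieRing g] [LieAlgebra ℂ g] [FiniteDimensional ℂ g]
    [LieAlgebra.IsKilling ℂ g]
    (H : LieSubalgebra ℂ g) [H.IsCartanSubalgebra] [LieModule.IsTriangularizable ℂ H g]
    (r : ℕ) (α : Fin (r + 1) → Module.Dual ℂ H) (n : Fin (r + 1) → ℂ)
    (x y : Fin (r + 1) → g)
    (hroot : ∀ i, α i ≠ 0 ∧ ∃ z : g, z ≠ 0 ∧ ∀ h : H, ⁅(h : g), z⁆ = α i h • z)
    (hsum : ∑ i, n i • α i = 0)
    (hdiff : ∀ i j, i ≠ j → (α i - α j ≠ 0 ∧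
      ¬ ∃ z : g, z ≠ 0 ∧ ∀ h : H, ⁅(h : g), z⁆ = (α i - α j) h • z))
    (hx : ∀ i, ∀ h : H, ⁅(h : g), x i⁆ = α i h • x i)
    (hy : ∀ i, ∀ h : H, ⁅(h : g), y i⁆ = -(α i h) • y i)
    (hκ : ∀ i, killingForm ℂ g (x i) (y i) = n i) :
    ⁅∑ i, x i, ∑ i, y i⁆ = 0 := by
  have hoff : ∀ i j, j ≠ i → ⁅x i, y j⁆ = 0 := by
    intro i j hij
    by_contra hne
    refine (hdiff i j hij.symm).2 ⟨⁅x i, y j⁆, hne, fun h ↦ ?_⟩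
    rw [lie_lie_eq_add_smul (hx i h) (hy j h), LinearMap.sub_apply, sub_eq_add_neg]
  calc ⁅∑ i, x i, ∑ i, y i⁆ = ∑ i, ⁅x i, y i⁆ := by
        simp_rw [sum_lie, lie_sum]
        exact Finset.sum_congr rfl fun i _ ↦
          Finset.sum_eq_single i (fun j _ hj ↦ hoff i j hj) (by simp)
    _ = ∑ i, n i • ((LieAlgebra.IsKilling.cartanEquivDual H).symm (α i) : g) :=
        Finset.sum_congr rfl fun i _ ↦ by
          rw [lie_eq_killingForm_smul_cartanEquivDual_symm H (hx i) (hy i), hκ i]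
    _ = ((LieAlgebra.IsKilling.cartanEquivDual H).symm (∑ i, n i • α i) : g) := by
        simp
    _ = 0 := by simp [hsum]
end

section
/- Let n ≥ 2 and let k be an integer with 1 ≤ k ≤ n−1; set p = gcd(k, n) and q = n/p. Then sin(kjπ/n) = 0 exactly for the p − 1 indices j of the form j = a·q with 1 ≤ a ≤ p−1, and for each a ∈ {0, 1, …, p−1} the multiset { |sin(k(aq + t)π/n)| : t = 1, …, q−1 } equals the multiset { sin(tπ/q) : t = 1, …, q−1 }. (Section 7.1: the nonzero components of the eigenvector μ^{(k)} of the Cartan matrix of type A_{n−1} decompose into p clusters, each being, up to signs and a permutation, a Perron–Frobenius eigenvector for sl(q).) -/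
theorem abs_sin_nat_mul_pi_div_eq_sin_mod (N : ℕ) {q : ℕ} (hq : 0 < q) :
    |Real.sin ((N : ℝ) * Real.pi / (q : ℝ))| =
      Real.sin (((N % q : ℕ) : ℝ) * Real.pi / (q : ℝ)) := by
  have hq0 : (0 : ℝ) < q := by exact_mod_cast hq
  have hdiv : (N : ℝ) = ((N % q : ℕ) : ℝ) + (q : ℝ) * ((N / q : ℕ) : ℝ) := by
    exact_mod_cast (Nat.mod_add_div N q).symm
  have harg : (N : ℝ) * Real.pi / (q : ℝ) =
      ((N % q : ℕ) : ℝ) * Real.pi / (q : ℝ) + ((N / q : ℕ) : ℝ) * Real.pi := by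
    rw [hdiv, add_mul, add_div]
    congr 1
    field_simp
  have hmod : ((N % q : ℕ) : ℝ) ≤ q := by exact_mod_cast (Nat.mod_lt N hq).le
  rw [harg, Real.sin_add_nat_mul_pi, abs_mul, abs_neg_one_pow, one_mul, abs_of_nonneg]
  apply Real.sin_nonneg_of_nonneg_of_le_pi
  · positivity
  · rw [div_le_iff₀ hq0, mul_comm Real.pi]
    gcongr

theorem sin_nat_mul_pi_div_eq_zero_iff_dvd (N : ℕ) {q : ℕ} (hq : 0 < q) :
    Real.sin ((N : ℝ) * Real.pi / (q : ℝ)) = 0 ↔ q ∣ N := by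
  have hq0 : (q : ℝ) ≠ 0 := by exact_mod_cast hq.ne'
  rw [Real.sin_eq_zero_iff, ← Int.natCast_dvd_natCast]
  refine exists_congr fun c => ?_
  rw [eq_div_iff hq0, mul_right_comm, mul_left_inj' Real.pi_ne_zero, eq_comm, mul_comm]
  exact_mod_cast Iff.rfl

theorem map_affine_mod_Icc {m q : ℕ} (hmq : Nat.Coprime q m) (hq : 0 < q) (a : ℕ) :
    Multiset.map (fun t : ℕ => m * (a * q + t) % q) (Finset.Icc 1 (q - 1)).val =
      (Finset.Icc 1 (q - 1)).val := by
  have hmod (t : ℕ) : m * (a * q + t) % q = m * t % q := by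
    rw [mul_add, ← mul_assoc, Nat.mul_add_mod_self_right]
  simp only [hmod]
  have hinj : Set.InjOn (fun t : ℕ => m * t % q) (Finset.Icc 1 (q - 1)) := by
    intro s hs t ht hst
    rw [Finset.mem_coe, Finset.mem_Icc] at hs ht
    exact (Nat.ModEq.cancel_left_of_coprime hmq hst).eq_of_lt_of_lt (by omega) (by omega)
  rw [← Finset.image_val_of_injOn hinj]
  congr 1
  refine Finset.eq_of_subset_of_card_le ?_ (Finset.card_image_of_injOn hinj).ge
  intro x hx
  obtain ⟨t, ht, rfl⟩ := Finset.mem_image.mp hx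
  rw [Finset.mem_Icc] at ht ⊢
  have hlt := Nat.mod_lt (m * t) hq
  have hne : m * t % q ≠ 0 := fun h => by
    have := Nat.le_of_dvd (by omega) (hmq.dvd_of_dvd_mul_left (Nat.dvd_of_mod_eq_zero h))
    omega
  omega

/-- **Section 7.1.** Let `n ≥ 2`, `1 ≤ k ≤ n-1`, `p = gcd(k, n)`, `q = n/p`. Then
`sin(kjπ/n) = 0` (for `1 ≤ j ≤ n-1`) exactly for the `p - 1` indices `j = a·q` with
`1 ≤ a ≤ p-1`, and for each `a ∈ {0, …, p-1}` the multiset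
`{ |sin(k(aq+t)π/n)| : t = 1, …, q-1 }` equals `{ sin(tπ/q) : t = 1, …, q-1 }`:
the nonzero components of the eigenvector `μ^{(k)}` decompose into `p` clusters, each
being, up to signs and a permutation, a Perron–Frobenius eigenvector for `sl(q)`. -/
theorem stmt17 (n : ℕ) (hn : 2 ≤ n) (k : ℕ) (hk1 : 1 ≤ k) (hk2 : k ≤ n - 1)
    (p q : ℕ) (hp : p = Nat.gcd k n) (hq : q = n / p) :
    (∀ j : ℕ, 1 ≤ j → j ≤ n - 1 →
      (Real.sin ((k : ℝ) * (j : ℝ) * Real.pi / (n : ℝ)) = 0 ↔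
        ∃ a : ℕ, 1 ≤ a ∧ a ≤ p - 1 ∧ j = a * q)) ∧
    (∀ a : ℕ, a ≤ p - 1 →
      Multiset.map
          (fun t : ℕ => |Real.sin ((k : ℝ) * ((a * q + t : ℕ) : ℝ) * Real.pi / (n : ℝ))|)
          (Finset.Icc 1 (q - 1)).val =
        Multiset.map (fun t : ℕ => Real.sin ((t : ℝ) * Real.pi / (q : ℝ)))
          (Finset.Icc 1 (q - 1)).val) := by
  have hp0 : 0 < p := hp ▸ Nat.gcd_pos_of_pos_left n hk1
  have hpn : p ∣ n := hp ▸ Nat.gcd_dvd_right k n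
  have hn_eq : n = p * q := by rw [hq, Nat.mul_div_cancel' hpn]
  have hq0 : 0 < q := Nat.pos_of_ne_zero fun h => by simp [h] at hn_eq; omega
  obtain ⟨m, hm⟩ : p ∣ k := hp ▸ Nat.gcd_dvd_left k n
  have hmq : Nat.Coprime q m := by
    have h := hp
    rw [hm, hn_eq, Nat.gcd_mul_left] at h
    exact Nat.Coprime.symm (Nat.eq_of_mul_eq_mul_left hp0 (h.symm.trans (mul_one p).symm))
  have harg (j : ℕ) : (k : ℝ) * (j : ℝ) * Real.pi / (n : ℝ) =
      ((m * j : ℕ) : ℝ) * Real.pi / (q : ℝ) := by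
    have hp' : (p : ℝ) ≠ 0 := by exact_mod_cast hp0.ne'
    rw [hm, hn_eq]
    push_cast
    rw [mul_assoc, mul_assoc, mul_div_mul_left _ _ hp', ← mul_assoc]
  refine ⟨fun j hj1 hj2 => ?_, fun a _ => ?_⟩
  · rw [harg, sin_nat_mul_pi_div_eq_zero_iff_dvd _ hq0, hmq.dvd_mul_left]
    constructor
    · rintro ⟨a, rfl⟩
      have ha : 0 < a := Nat.pos_of_mul_pos_left hj1
      have hap : a < p := lt_of_mul_lt_mul_left (a := q) (by rw [mul_comm q p]; omega) hq0.le
      exact ⟨a, ha, by omega, mul_comm q a⟩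
    · rintro ⟨a, _, _, rfl⟩
      exact dvd_mul_left q a
  · simp only [harg, abs_sin_nat_mul_pi_div_eq_sin_mod _ hq0]
    conv_rhs => rw [← map_affine_mod_Icc hmq hq0 a, Multiset.map_map]
    rfl
end

section
/- Let E8 denote the Cartan matrix of type E_8 and set μ = 2cos(π/30). For every nonzero vector v ∈ ℝ^8 with E8·v = 2(1 − cos(π/30))·v, there is a real number s ≠ 0 such that the multiset { v_1, …, v_8 } equals the multiset { s·1, s·(μ^2 − 1)/μ, s·μ, s·(μ^2 − 1), s·(μ^4 − 3μ^2 + 1)/μ, s·(μ^4 − 4μ^2 + 2), s·(μ^6 − 5μ^4 + 5μ^2 − 1)/μ, s·(μ^6 − 6μ^4 + 9μ^2 − 3) }. (Example 7.3: the Perron–Frobenius eigenvector of the E_8 Cartan matrix.) -/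
/-- The Cartan matrix of type `E_8` (Bourbaki labelling: edges
{1,3}, {3,4}, {4,5}, {5,6}, {6,7}, {7,8}, {2,4}). -/
def cartanE8 : Matrix (Fin 8) (Fin 8) ℝ :=
  !![ 2,  0, -1,  0,  0,  0,  0,  0;
      0,  2,  0, -1,  0,  0,  0,  0;
     -1,  0,  2, -1,  0,  0,  0,  0;
      0, -1, -1,  2, -1,  0,  0,  0;
      0,  0,  0, -1,  2, -1,  0,  0;
      0,  0,  0,  0, -1,  2, -1,  0;
      0,  0,  0,  0,  0, -1,  2, -1;
      0,  0,  0,  0,  0,  0, -1,  2]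

/-- **Example 7.3.** Set `μ = 2cos(π/30)`. Every nonzero eigenvector of the `E_8` Cartan
matrix with eigenvalue `2(1 - cos(π/30))` has, as multiset of components, a nonzero
multiple of `{1, (μ²-1)/μ, μ, μ²-1, (μ⁴-3μ²+1)/μ, μ⁴-4μ²+2, (μ⁶-5μ⁴+5μ²-1)/μ,
μ⁶-6μ⁴+9μ²-3}`. -/
theorem stmt18 (μ : ℝ) (hμ : μ = 2 * Real.cos (Real.pi / 30))
    (v : Fin 8 → ℝ) (hv0 : v ≠ 0)
    (hv : cartanE8.mulVec v = (2 * (1 - Real.cos (Real.pi / 30))) • v) :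
    ∃ s : ℝ, s ≠ 0 ∧
      ({v 0, v 1, v 2, v 3, v 4, v 5, v 6, v 7} : Multiset ℝ) =
      {s * 1, s * ((μ ^ 2 - 1) / μ), s * μ, s * (μ ^ 2 - 1),
       s * ((μ ^ 4 - 3 * μ ^ 2 + 1) / μ), s * (μ ^ 4 - 4 * μ ^ 2 + 2),
       s * ((μ ^ 6 - 5 * μ ^ 4 + 5 * μ ^ 2 - 1) / μ),
       s * (μ ^ 6 - 6 * μ ^ 4 + 9 * μ ^ 2 - 3)} := by
  have hμ0 : μ ≠ 0 := by
    rw [hμ]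
    have := Real.cos_pos_of_mem_Ioo (x := Real.pi / 30)
      ⟨by linarith [Real.pi_pos], by linarith [Real.pi_pos]⟩
    positivity
  rw [show 2 * (1 - Real.cos (Real.pi / 30)) = 2 - μ by rw [hμ]; ring] at hv
  have h0 := congrFun hv 0
  have h1 := congrFun hv 1
  have h2 := congrFun hv 2
  have h3 := congrFun hv 3
  have h4 := congrFun hv 4
  have h5 := congrFun hv 5
  have h6 := congrFun hv 6
  simp [cartanE8, Matrix.mulVec, dotProduct, Fin.sum_univ_eight] at h0 h1 h2 h3 h4 h5 h6
  have e2 : v 2 = v 0 * μ := by linarith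
  have e3 : v 3 = v 0 * (μ ^ 2 - 1) := by
    rw [e2] at h2
    linarith
  have e1 : v 1 = v 0 * ((μ ^ 2 - 1) / μ) := by
    rw [e3] at h1
    field_simp
    linarith
  have e4 : v 4 = v 0 * ((μ ^ 4 - 3 * μ ^ 2 + 1) / μ) := by
    have : v 4 = μ * v 3 - v 1 - v 2 := by linarith
    rw [this, e1, e2, e3]
    field_simp
    ring
  have e5 : v 5 = v 0 * (μ ^ 4 - 4 * μ ^ 2 + 2) := by
    have : v 5 = μ * v 4 - v 3 := by linarith
    rw [this, e3, e4]
    field_simp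
    ring
  have e6 : v 6 = v 0 * ((μ ^ 6 - 5 * μ ^ 4 + 5 * μ ^ 2 - 1) / μ) := by
    have : v 6 = μ * v 5 - v 4 := by linarith
    rw [this, e4, e5]
    field_simp
    ring
  have e7 : v 7 = v 0 * (μ ^ 6 - 6 * μ ^ 4 + 9 * μ ^ 2 - 3) := by
    have : v 7 = μ * v 6 - v 5 := by linarith
    rw [this, e5, e6]
    field_simp
    ring
  refine ⟨v 0, fun h => hv0 ?_, ?_⟩
  · funext i
    fin_cases i <;> simp [e1, e2, e3, e4, e5, e6, e7, h]
  · rw [e1, e2, e3, e4, e5, e6, e7, mul_one]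
end

section
/- Let E8 denote the Cartan matrix of type E_8 and let k ∈ {7, 11, 13, 17, 19, 23, 29}. For every nonzero v ∈ ℝ^8 with E8·v = 2(1 − cos(π/30))·v and every nonzero w ∈ ℝ^8 with E8·w = 2(1 − cos(kπ/30))·w, there exists a real number t > 0 such that the multiset { |w_1|, …, |w_8| } equals the multiset { t·|v_1|, …, t·|v_8| }. (Example 7.3 / Proposition 7.2(a) for E_8: for every exponent k coprime to h = 30, the components of the eigenvector with eigenvalue 2(1 − cos(kπ/30)) are, up to signs and a permutation, proportional to those of the Perron–Frobenius eigenvector.) -/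
theorem cartanE8_mulVec_eq_iff (y : ℝ) (v : Fin 8 → ℝ) :
    cartanE8.mulVec v = (2 - y) • v ↔
      v 2 = y * v 0 ∧ v 3 = y * v 1 ∧ v 0 + v 3 = y * v 2 ∧ v 1 + v 2 + v 4 = y * v 3 ∧
        v 3 + v 5 = y * v 4 ∧ v 4 + v 6 = y * v 5 ∧ v 5 + v 7 = y * v 6 ∧ v 6 = y * v 7 := by
  simp only [funext_iff, Fin.forall_fin_succ, cartanE8, Matrix.mulVec, dotProduct,
    Fin.sum_univ_eight, Pi.smul_apply, smul_eq_mul]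
  simp
  constructor
  · rintro ⟨h0, h1, h2, h3, h4, h5, h6, h7⟩
    refine ⟨?_, ?_, ?_, ?_, ?_, ?_, ?_, ?_⟩ <;> linarith
  · rintro ⟨h0, h1, h2, h3, h4, h5, h6, h7⟩
    refine ⟨?_, ?_, ?_, ?_, ?_, ?_, ?_, ?_⟩ <;> linarith

/-- The polynomial in `hx` is the minimal polynomial of `2 cos (π / 30)`. -/
theorem eigenvector_coords {x : ℝ} {v : Fin 8 → ℝ}
    (hx : x ^ 8 - 7 * x ^ 6 + 14 * x ^ 4 - 8 * x ^ 2 + 1 = 0)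
    (hv : cartanE8.mulVec v = (2 - x) • v) :
    v 0 = (x ^ 6 - 6 * x ^ 4 + 9 * x ^ 2 - 2) * v 7 ∧
      v 1 = (-x ^ 7 + 7 * x ^ 5 - 13 * x ^ 3 + 5 * x) * v 7 ∧
      v 2 = (x ^ 7 - 6 * x ^ 5 + 9 * x ^ 3 - 2 * x) * v 7 ∧
      v 3 = (x ^ 4 - 3 * x ^ 2 + 1) * v 7 ∧ v 4 = (x ^ 3 - 2 * x) * v 7 ∧
      v 5 = (x ^ 2 - 1) * v 7 ∧ v 6 = x * v 7 := by
  rw [cartanE8_mulVec_eq_iff] at hv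
  obtain ⟨e0, e1, e2, e3, e4, e5, e6, e7⟩ := hv
  have h5 : v 5 = (x ^ 2 - 1) * v 7 := by linear_combination e6 + x * e7
  have h4 : v 4 = (x ^ 3 - 2 * x) * v 7 := by linear_combination e5 + x * h5 - e7
  have h3 : v 3 = (x ^ 4 - 3 * x ^ 2 + 1) * v 7 := by linear_combination e4 + x * h4 - h5
  have h1 : v 1 = (-x ^ 7 + 7 * x ^ 5 - 13 * x ^ 3 + 5 * x) * v 7 := by
    linear_combination v 1 * hx
      + (-x ^ 7 + 7 * x ^ 5 - 14 * x ^ 3 + 8 * x) * (h3 - e1)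
      + (-x ^ 3 + 3 * x) * v 7 * hx
  have h2 : v 2 = (x ^ 7 - 6 * x ^ 5 + 9 * x ^ 3 - 2 * x) * v 7 := by
    linear_combination e3 + x * h3 - h1 - h4
  have h0 : v 0 = (x ^ 6 - 6 * x ^ 4 + 9 * x ^ 2 - 2) * v 7 := by
    linear_combination e2 + x * h2 - h3 + v 7 * hx
  exact ⟨h0, h1, h2, h3, h4, h5, e7⟩

theorem exists_permuted_eigenvector_7 {x : ℝ} {v : Fin 8 → ℝ}
    (hx : x ^ 8 - 7 * x ^ 6 + 14 * x ^ 4 - 8 * x ^ 2 + 1 = 0)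
    (hv : cartanE8.mulVec v = (2 - x) • v) :
    ∃ (u : Fin 8 → ℝ) (σ : Equiv.Perm (Fin 8)),
      cartanE8.mulVec u = (2 - (x ^ 7 - 7 * x ^ 5 + 14 * x ^ 3 - 7 * x)) • u ∧
        ∀ i, |u i| = |v (σ i)| := by
  obtain ⟨h0, h1, h2, h3, h4, h5, h6⟩ := eigenvector_coords hx hv
  refine ⟨![-v 6, -v 0, -v 5, -v 1, v 7, v 4, v 3, v 2],
    ⟨![6, 0, 5, 1, 7, 4, 3, 2], ![1, 3, 7, 6, 5, 2, 0, 4], by decide, by decide⟩, ?_, ?_⟩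
  · rw [cartanE8_mulVec_eq_iff]
    simp only [Matrix.cons_val]
    rw [h0, h1, h2, h3, h4, h5, h6]
    refine ⟨?_, ?_, ?_, ?_, ?_, ?_, ?_, ?_⟩
    · linear_combination v 7 * hx
    · linear_combination (x ^ 5 - 6 * x ^ 3 + 9 * x) * v 7 * hx
    · linear_combination x * v 7 * hx
    · linear_combination (-x ^ 6 + 7 * x ^ 4 - 13 * x ^ 2 + 4) * v 7 * hx
    · ring
    · linear_combination (-x ^ 2 + 2) * v 7 * hx
    · linear_combination (-x ^ 3 + 3 * x) * v 7 * hx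
    · linear_combination (-x ^ 6 + 6 * x ^ 4 - 9 * x ^ 2 + 1) * v 7 * hx
  · intro i
    fin_cases i <;> simp

theorem exists_permuted_eigenvector_11 {x : ℝ} {v : Fin 8 → ℝ}
    (hx : x ^ 8 - 7 * x ^ 6 + 14 * x ^ 4 - 8 * x ^ 2 + 1 = 0)
    (hv : cartanE8.mulVec v = (2 - x) • v) :
    ∃ (u : Fin 8 → ℝ) (σ : Equiv.Perm (Fin 8)),
      cartanE8.mulVec u = (2 - (2 * x ^ 7 - 13 * x ^ 5 + 22 * x ^ 3 - 7 * x)) • u ∧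
        ∀ i, |u i| = |v (σ i)| := by
  obtain ⟨h0, h1, h2, h3, h4, h5, h6⟩ := eigenvector_coords hx hv
  refine ⟨![v 3, -v 6, v 4, -v 0, -v 2, -v 7, v 1, v 5],
    ⟨![3, 6, 4, 0, 2, 7, 1, 5], ![3, 6, 4, 0, 2, 7, 1, 5], by decide, by decide⟩, ?_, ?_⟩
  · rw [cartanE8_mulVec_eq_iff]
    simp only [Matrix.cons_val]
    rw [h0, h1, h2, h3, h4, h5, h6]
    refine ⟨?_, ?_, ?_, ?_, ?_, ?_, ?_, ?_⟩
    · linear_combination (-2 * x ^ 3 + 5 * x) * v 7 * hx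
    · linear_combination (2) * v 7 * hx
    · linear_combination (-2 * x ^ 2 + 3) * v 7 * hx
    · linear_combination (2 * x ^ 5 - 11 * x ^ 3 + 13 * x) * v 7 * hx
    · linear_combination (2 * x ^ 6 - 11 * x ^ 4 + 13 * x ^ 2 + 1) * v 7 * hx
    · ring
    · linear_combination (2 * x ^ 6 - 13 * x ^ 4 + 20 * x ^ 2 - 2) * v 7 * hx
    · linear_combination (-2 * x) * v 7 * hx
  · intro i
    fin_cases i <;> simp

theorem exists_permuted_eigenvector_13 {x : ℝ} {v : Fin 8 → ℝ}
    (hx : x ^ 8 - 7 * x ^ 6 + 14 * x ^ 4 - 8 * x ^ 2 + 1 = 0)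
    (hv : cartanE8.mulVec v = (2 - x) • v) :
    ∃ (u : Fin 8 → ℝ) (σ : Equiv.Perm (Fin 8)),
      cartanE8.mulVec u = (2 - (-x ^ 7 + 7 * x ^ 5 - 13 * x ^ 3 + 4 * x)) • u ∧
        ∀ i, |u i| = |v (σ i)| := by
  obtain ⟨h0, h1, h2, h3, h4, h5, h6⟩ := eigenvector_coords hx hv
  refine ⟨![-v 1, v 3, -v 7, v 6, -v 5, -v 2, v 0, v 4],
    ⟨![1, 3, 7, 6, 5, 2, 0, 4], ![6, 0, 5, 1, 7, 4, 3, 2], by decide, by decide⟩, ?_, ?_⟩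
  · rw [cartanE8_mulVec_eq_iff]
    simp only [Matrix.cons_val]
    rw [h0, h1, h2, h3, h4, h5, h6]
    refine ⟨?_, ?_, ?_, ?_, ?_, ?_, ?_, ?_⟩
    · linear_combination (x ^ 6 - 7 * x ^ 4 + 12 * x ^ 2 - 1) * v 7 * hx
    · linear_combination (x ^ 3 - 3 * x) * v 7 * hx
    · ring
    · linear_combination v 7 * hx
    · linear_combination (-x) * v 7 * hx
    · linear_combination (-x ^ 6 + 6 * x ^ 4 - 8 * x ^ 2 - 1) * v 7 * hx
    · linear_combination (x ^ 5 - 6 * x ^ 3 + 8 * x) * v 7 * hx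
    · linear_combination (x ^ 2 - 2) * v 7 * hx
  · intro i
    fin_cases i <;> simp

/-- The `E_8` diagram is bipartite, so changing signs on one colour class negates the
eigenvalues of its adjacency matrix. -/
theorem exists_negated_eigenvector {y : ℝ} {u : Fin 8 → ℝ}
    (hu : cartanE8.mulVec u = (2 - y) • u) :
    ∃ u' : Fin 8 → ℝ, cartanE8.mulVec u' = (2 - -y) • u' ∧ ∀ i, |u' i| = |u i| := by
  rw [cartanE8_mulVec_eq_iff] at hu
  obtain ⟨e0, e1, e2, e3, e4, e5, e6, e7⟩ := hu
  refine ⟨![u 0, -u 1, -u 2, u 3, -u 4, u 5, -u 6, u 7], ?_, ?_⟩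
  · rw [cartanE8_mulVec_eq_iff]
    simp only [Matrix.cons_val]
    refine ⟨?_, ?_, ?_, ?_, ?_, ?_, ?_, ?_⟩ <;> linarith
  · intro i
    fin_cases i <;> simp

theorem eigenvector_eq_zero_of_last_eq_zero {y : ℝ} {z : Fin 8 → ℝ} (hy0 : y ≠ 0)
    (hy1 : y ^ 2 ≠ 1) (hz : cartanE8.mulVec z = (2 - y) • z) (h7 : z 7 = 0) : z = 0 := by
  rw [cartanE8_mulVec_eq_iff] at hz
  obtain ⟨e0, e1, e2, e3, e4, e5, e6, e7⟩ := hz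
  have h6 : z 6 = 0 := by linear_combination e7 + y * h7
  have h5 : z 5 = 0 := by linear_combination e6 + y * h6 - h7
  have h4 : z 4 = 0 := by linear_combination e5 + y * h5 - h6
  have h3 : z 3 = 0 := by linear_combination e4 + y * h4 - h5
  have h1 : z 1 = 0 :=
    (mul_eq_zero.mp (by linear_combination h3 - e1 : y * z 1 = 0)).resolve_left hy0
  have h0 : z 0 = 0 :=
    (mul_eq_zero.mp (by linear_combination h3 - e2 - y * e0 : (y ^ 2 - 1) * z 0 = 0)).resolve_left
      (sub_ne_zero.mpr hy1)
  have h2 : z 2 = 0 := by linear_combination e0 + y * h0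
  funext i
  fin_cases i
  exacts [h0, h1, h2, h3, h4, h5, h6, h7]

theorem eigenvector_proportional {y : ℝ} {u w : Fin 8 → ℝ} (hy0 : y ≠ 0) (hy1 : y ^ 2 ≠ 1)
    (hu : cartanE8.mulVec u = (2 - y) • u) (hw : cartanE8.mulVec w = (2 - y) • w) (i : Fin 8) :
    u 7 * w i = w 7 * u i := by
  have hz : u 7 • w - w 7 • u = 0 := by
    refine eigenvector_eq_zero_of_last_eq_zero hy0 hy1 ?_ ?_
    · rw [Matrix.mulVec_sub, Matrix.mulVec_smul, Matrix.mulVec_smul, hu, hw, smul_sub,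
        smul_comm (u 7), smul_comm (w 7)]
    · simp [mul_comm]
  simpa [sub_eq_zero] using congrFun hz i

theorem two_cos_add (a b : ℝ) :
    2 * Real.cos (a + b) = 2 * Real.cos a * (2 * Real.cos b) - 2 * Real.cos (a - b) := by
  rw [Real.cos_add, Real.cos_sub]
  ring

theorem two_cos_multiples (φ : ℝ) :
    2 * Real.cos (7 * φ) = (2 * Real.cos φ) ^ 7 - 7 * (2 * Real.cos φ) ^ 5
        + 14 * (2 * Real.cos φ) ^ 3 - 7 * (2 * Real.cos φ) ∧
      2 * Real.cos (10 * φ) = (2 * Real.cos φ) ^ 10 - 10 * (2 * Real.cos φ) ^ 8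
        + 35 * (2 * Real.cos φ) ^ 6 - 50 * (2 * Real.cos φ) ^ 4
        + 25 * (2 * Real.cos φ) ^ 2 - 2 ∧
      2 * Real.cos (11 * φ) = (2 * Real.cos φ) ^ 11 - 11 * (2 * Real.cos φ) ^ 9
        + 44 * (2 * Real.cos φ) ^ 7 - 77 * (2 * Real.cos φ) ^ 5
        + 55 * (2 * Real.cos φ) ^ 3 - 11 * (2 * Real.cos φ) ∧
      2 * Real.cos (13 * φ) = (2 * Real.cos φ) ^ 13 - 13 * (2 * Real.cos φ) ^ 11
        + 65 * (2 * Real.cos φ) ^ 9 - 156 * (2 * Real.cos φ) ^ 7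
        + 182 * (2 * Real.cos φ) ^ 5 - 91 * (2 * Real.cos φ) ^ 3
        + 13 * (2 * Real.cos φ) := by
  generalize hx : 2 * Real.cos φ = x
  have h2 : 2 * Real.cos (2 * φ) = x ^ 2 - 2 := by
    rw [show 2 * φ = φ + φ by ring, two_cos_add, show φ - φ = 0 by ring,
      hx, Real.cos_zero]
    ring
  have h3 : 2 * Real.cos (3 * φ) = x ^ 3 - 3 * x := by
    rw [show 3 * φ = 2 * φ + φ by ring, two_cos_add, show 2 * φ - φ = φ by ring,
      h2, hx]
    ring
  have h4 : 2 * Real.cos (4 * φ) = x ^ 4 - 4 * x ^ 2 + 2 := by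
    rw [show 4 * φ = 2 * φ + 2 * φ by ring, two_cos_add, show 2 * φ - 2 * φ = 0 by ring,
      h2, Real.cos_zero]
    ring
  have h5 : 2 * Real.cos (5 * φ) = x ^ 5 - 5 * x ^ 3 + 5 * x := by
    rw [show 5 * φ = 3 * φ + 2 * φ by ring, two_cos_add, show 3 * φ - 2 * φ = φ by ring,
      h3, h2, hx]
    ring
  have h6 : 2 * Real.cos (6 * φ) = x ^ 6 - 6 * x ^ 4 + 9 * x ^ 2 - 2 := by
    rw [show 6 * φ = 3 * φ + 3 * φ by ring, two_cos_add, show 3 * φ - 3 * φ = 0 by ring,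
      h3, Real.cos_zero]
    ring
  have h7 : 2 * Real.cos (7 * φ) = x ^ 7 - 7 * x ^ 5 + 14 * x ^ 3 - 7 * x := by
    rw [show 7 * φ = 4 * φ + 3 * φ by ring, two_cos_add, show 4 * φ - 3 * φ = φ by ring,
      h4, h3, hx]
    ring
  have h10 : 2 * Real.cos (10 * φ) = x ^ 10 - 10 * x ^ 8 + 35 * x ^ 6 - 50 * x ^ 4
      + 25 * x ^ 2 - 2 := by
    rw [show 10 * φ = 5 * φ + 5 * φ by ring, two_cos_add, show 5 * φ - 5 * φ = 0 by ring,
      h5, Real.cos_zero]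
    ring
  have h11 : 2 * Real.cos (11 * φ) = x ^ 11 - 11 * x ^ 9 + 44 * x ^ 7 - 77 * x ^ 5
      + 55 * x ^ 3 - 11 * x := by
    rw [show 11 * φ = 6 * φ + 5 * φ by ring, two_cos_add, show 6 * φ - 5 * φ = φ by ring,
      h6, h5, hx]
    ring
  have h13 : 2 * Real.cos (13 * φ) = x ^ 13 - 13 * x ^ 11 + 65 * x ^ 9 - 156 * x ^ 7 + 182 * x ^ 5
      - 91 * x ^ 3 + 13 * x := by
    rw [show 13 * φ = 7 * φ + 6 * φ by ring, two_cos_add, show 7 * φ - 6 * φ = φ by ring,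
      h7, h6, hx]
    ring
  exact ⟨h7, h10, h11, h13⟩

theorem two_cos_pi_div_thirty_isRoot {x : ℝ} (hx : x = 2 * Real.cos (Real.pi / 30)) :
    x ^ 8 - 7 * x ^ 6 + 14 * x ^ 4 - 8 * x ^ 2 + 1 = 0 := by
  have h10 := (two_cos_multiples (Real.pi / 30)).2.1
  rw [show 10 * (Real.pi / 30) = Real.pi / 3 by ring, Real.cos_pi_div_three, ← hx] at h10
  have h3 : x ^ 2 - 3 ≠ 0 := by
    have hlt : Real.cos (Real.pi / 6) < Real.cos (Real.pi / 30) :=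
      Real.cos_lt_cos_of_nonneg_of_le_pi (by positivity) (by linarith [Real.pi_pos])
        (by linarith [Real.pi_pos])
    rw [Real.cos_pi_div_six] at hlt
    have hs : √3 < x := by linarith
    have := Real.lt_sq_of_sqrt_lt hs
    linarith
  exact mul_left_cancel₀ h3 (by linear_combination -h10)

theorem two_cos_ne_of_two_cos_ten_mul {φ : ℝ} (h : 2 * Real.cos (10 * φ) = 1) :
    2 * Real.cos φ ≠ 0 ∧ (2 * Real.cos φ) ^ 2 ≠ 1 := by
  rw [(two_cos_multiples φ).2.1] at h
  refine ⟨fun h0 => ?_, fun h1 => ?_⟩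
  · rw [h0] at h
    norm_num at h
  · generalize 2 * Real.cos φ = y at h h1
    rw [show y ^ 10 = (y ^ 2) ^ 5 by ring, show y ^ 8 = (y ^ 2) ^ 4 by ring,
      show y ^ 6 = (y ^ 2) ^ 3 by ring, show y ^ 4 = (y ^ 2) ^ 2 by ring, h1] at h
    norm_num at h

theorem cos_mul_pi_div_three {k : ℕ} (hk : k % 6 = 1 ∨ k % 6 = 5) :
    Real.cos (k * (Real.pi / 3)) = 1 / 2 := by
  rw [← Real.cos_pi_div_three]
  rcases hk with hk | hk
  · obtain ⟨m, rfl⟩ : ∃ m, k = 6 * m + 1 := ⟨k / 6, by omega⟩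
    rw [← Real.cos_add_nat_mul_two_pi (Real.pi / 3) m]
    congr 1
    push_cast
    ring
  · obtain ⟨m, rfl⟩ : ∃ m, k = 6 * m + 5 := ⟨k / 6, by omega⟩
    rw [← Real.cos_nat_mul_two_pi_sub (Real.pi / 3) (m + 1)]
    congr 1
    push_cast
    ring

theorem exists_permuted_eigenvector {k : ℕ}
    (hk : k ∈ ({7, 11, 13, 17, 19, 23, 29} : Finset ℕ)) {v : Fin 8 → ℝ}
    (hv : cartanE8.mulVec v = (2 - 2 * Real.cos (Real.pi / 30)) • v) :
    ∃ (u : Fin 8 → ℝ) (σ : Equiv.Perm (Fin 8)),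
      cartanE8.mulVec u = (2 - 2 * Real.cos (k * (Real.pi / 30))) • u ∧
        ∀ i, |u i| = |v (σ i)| := by
  obtain ⟨c7, -, c11, c13⟩ := two_cos_multiples (Real.pi / 30)
  generalize hx : 2 * Real.cos (Real.pi / 30) = x at *
  have hx0 := two_cos_pi_div_thirty_isRoot hx.symm
  have h7 := exists_permuted_eigenvector_7 hx0 hv
  have h11 := exists_permuted_eigenvector_11 hx0 hv
  have h13 := exists_permuted_eigenvector_13 hx0 hv
  rw [← c7] at h7
  rw [show 2 * x ^ 7 - 13 * x ^ 5 + 22 * x ^ 3 - 7 * x = 2 * Real.cos (11 * (Real.pi / 30)) by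
    linear_combination -c11 - (x ^ 3 - 4 * x) * hx0] at h11
  rw [show -x ^ 7 + 7 * x ^ 5 - 13 * x ^ 3 + 4 * x = 2 * Real.cos (13 * (Real.pi / 30)) by
    linear_combination -c13 - (x ^ 5 - 6 * x ^ 3 + 9 * x) * hx0] at h13
  have h1 : ∃ (u : Fin 8 → ℝ) (σ : Equiv.Perm (Fin 8)),
      cartanE8.mulVec u = (2 - 2 * Real.cos (1 * (Real.pi / 30))) • u ∧
        ∀ i, |u i| = |v (σ i)| := ⟨v, 1, by rwa [one_mul, hx], fun _ => rfl⟩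
  have key {a b : ℝ} (hab : a + b = 30)
      (h : ∃ (u : Fin 8 → ℝ) (σ : Equiv.Perm (Fin 8)),
        cartanE8.mulVec u = (2 - 2 * Real.cos (a * (Real.pi / 30))) • u ∧
          ∀ i, |u i| = |v (σ i)|) :
      ∃ (u : Fin 8 → ℝ) (σ : Equiv.Perm (Fin 8)),
        cartanE8.mulVec u = (2 - 2 * Real.cos (b * (Real.pi / 30))) • u ∧
          ∀ i, |u i| = |v (σ i)| := by
    obtain ⟨u, σ, hu, huv⟩ := h
    obtain ⟨u', hu', huu⟩ := exists_negated_eigenvector hu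
    refine ⟨u', σ, ?_, fun i => (huu i).trans (huv i)⟩
    rwa [show b * (Real.pi / 30) = Real.pi - a * (Real.pi / 30) by
      linear_combination hab * (Real.pi / 30), Real.cos_pi_sub, mul_neg]
  simp only [Finset.mem_insert, Finset.mem_singleton] at hk
  rcases hk with rfl | rfl | rfl | rfl | rfl | rfl | rfl
  · exact h7
  · exact h11
  · exact h13
  · exact key (by norm_num) h13
  · exact key (by norm_num) h11
  · exact key (by norm_num) h7
  · exact key (by norm_num) h1

theorem multiset_eq_of_perm {α : Type*} {f g : Fin 8 → α} (σ : Equiv.Perm (Fin 8))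
    (h : ∀ i, f i = g (σ i)) :
    ({f 0, f 1, f 2, f 3, f 4, f 5, f 6, f 7} : Multiset α) =
      {g 0, g 1, g 2, g 3, g 4, g 5, g 6, g 7} := by
  change Finset.univ.val.map f = Finset.univ.val.map g
  rw [show f = g ∘ σ from funext h, ← Multiset.map_map, Multiset.map_univ_val_equiv]

/-- **Example 7.3 / Proposition 7.2(a) for `E_8`.** Let `k` be one of the exponents
`7, 11, 13, 17, 19, 23, 29` of `E_8` (those `> 1`, all coprime to `h = 30`). For every
nonzero `v` with `E8·v = 2(1 - cos(π/30))·v` and every nonzero `w` with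
`E8·w = 2(1 - cos(kπ/30))·w`, there is `t > 0` such that the multiset
`{|w_1|, …, |w_8|}` equals `{t·|v_1|, …, t·|v_8|}`. -/
theorem stmt19 (k : ℕ) (hk : k ∈ ({7, 11, 13, 17, 19, 23, 29} : Finset ℕ))
    (v w : Fin 8 → ℝ) (hv0 : v ≠ 0) (hw0 : w ≠ 0)
    (hv : cartanE8.mulVec v = (2 * (1 - Real.cos (Real.pi / 30))) • v)
    (hw : cartanE8.mulVec w = (2 * (1 - Real.cos ((k : ℝ) * Real.pi / 30))) • w) :
    ∃ t : ℝ, 0 < t ∧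
      ({|w 0|, |w 1|, |w 2|, |w 3|, |w 4|, |w 5|, |w 6|, |w 7|} : Multiset ℝ) =
      {t * |v 0|, t * |v 1|, t * |v 2|, t * |v 3|,
       t * |v 4|, t * |v 5|, t * |v 6|, t * |v 7|} := by
  rw [mul_one_sub] at hv hw
  rw [mul_div_assoc] at hw
  obtain ⟨u, σ, hu, huv⟩ := exists_permuted_eigenvector hk hv
  have hk6 : k % 6 = 1 ∨ k % 6 = 5 := by
    simp only [Finset.mem_insert, Finset.mem_singleton] at hk
    omega
  obtain ⟨hy0, hy1⟩ : 2 * Real.cos (k * (Real.pi / 30)) ≠ 0 ∧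
      (2 * Real.cos (k * (Real.pi / 30))) ^ 2 ≠ 1 := by
    apply two_cos_ne_of_two_cos_ten_mul
    rw [show 10 * (k * (Real.pi / 30)) = k * (Real.pi / 3) by ring, cos_mul_pi_div_three hk6]
    norm_num
  have hu0 : u ≠ 0 := by
    rintro rfl
    refine hv0 (funext fun i => ?_)
    simpa using (huv (σ.symm i)).symm
  have hu7 : u 7 ≠ 0 := mt (eigenvector_eq_zero_of_last_eq_zero hy0 hy1 hu) hu0
  have hw7 : w 7 ≠ 0 := mt (eigenvector_eq_zero_of_last_eq_zero hy0 hy1 hw) hw0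
  refine ⟨|w 7| / |u 7|, by positivity, ?_⟩
  refine multiset_eq_of_perm (f := fun i => |w i|) (g := fun i => |w 7| / |u 7| * |v i|) σ
    fun i => ?_
  rw [← huv, div_mul_eq_mul_div, eq_div_iff (abs_ne_zero.mpr hu7), ← abs_mul, ← abs_mul,
    mul_comm (w i), eigenvector_proportional hy0 hy1 hu hw]
end
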